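/- arXiv:1909.01580 — 4 statements merged into one kernel-verified Lean document; each statement's English description precedes it below -/
import Mathlib

section
/- Let E be a finite-dimensional real normed vector space, let L : E → E be four times continuously differentiable, and let y : ℝ → E solve the autonomous ODE y'(t) = L(y(t)) with y(0) = q₀. For Δt > 0 define the intermediate state Q*(Δt) = q₀ + (Δt/2)·L(q₀) + (Δt²/8)·DL(q₀)[L(q₀)] and the two-stage update S(Δt) = q₀ + Δt·L(q₀) + (Δt²/6)·( DL(q₀)[L(q₀)] + 2·DL(Q*(Δt))[L(Q*(Δt))] ), where DL(q)[v] denotes the Fréchet derivative of L at q applied to v. Then the update is fourth-order time accurate: there exist constants C > 0 and δ > 0 such that ‖S(Δt) − y(Δt)‖ ≤ C·Δt⁵ for all Δt ∈ (0, δ]. -/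
theorem aux_int {E : Type*} [NormedAddCommGroup E] [NormedSpace ℝ E]
    (f f' : ℝ → E) (hf : ∀ t, HasDerivAt f (f' t) t) (h0 : f 0 = 0) (C : ℝ) (hC : 0 ≤ C) (n : ℕ)
    (hb : ∀ t ∈ Set.Icc (0:ℝ) 1, ‖f' t‖ ≤ C * t ^ n) :
    ∀ t ∈ Set.Icc (0:ℝ) 1, ‖f t‖ ≤ C * t ^ (n+1) := by
  intro t ht
  have := (convex_Icc (0:ℝ) t).norm_image_sub_le_of_norm_hasDerivWithin_le (f := f) (f' := f')
    (C := C * t ^ n) (fun x _ => (hf x).hasDerivWithinAt)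
    (fun x hx => (hb x ⟨hx.1, hx.2.trans ht.2⟩).trans (by
      have := hx.1; have := hx.2; gcongr))
    (Set.left_mem_Icc.2 ht.1) (Set.right_mem_Icc.2 ht.1)
  rw [h0, sub_zero, sub_zero, Real.norm_of_nonneg ht.1] at this
  rw [pow_succ, ← mul_assoc]; exact this

/-- Two-stage fourth-order temporal discretization: for the autonomous ODE
`y' = L(y)`, `y(0) = q₀`, with `L` four times continuously differentiable on a
finite-dimensional real normed space, the two-stage update
`S(Δt) = q₀ + Δt·L(q₀) + (Δt²/6)(DL(q₀)[L(q₀)] + 2·DL(Q*)[L(Q*)])` with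
`Q* = q₀ + (Δt/2)·L(q₀) + (Δt²/8)·DL(q₀)[L(q₀)]` is fourth-order time
accurate: `‖S(Δt) − y(Δt)‖ ≤ C·Δt⁵` for all sufficiently small `Δt > 0`. -/
theorem two_stage_fourth_order
    {E : Type*} [NormedAddCommGroup E] [NormedSpace ℝ E] [FiniteDimensional ℝ E]
    (L : E → E) (hL : ContDiff ℝ 4 L)
    (y : ℝ → E) (hy : ∀ t : ℝ, HasDerivAt y (L (y t)) t)
    (q₀ : E) (hy0 : y 0 = q₀)
    (Qstar : ℝ → E)
    (hQstar : ∀ Δt : ℝ, Qstar Δt =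
      q₀ + (Δt / 2) • L q₀ + (Δt ^ 2 / 8) • (fderiv ℝ L q₀ (L q₀)))
    (S : ℝ → E)
    (hS : ∀ Δt : ℝ, S Δt =
      q₀ + Δt • L q₀ + (Δt ^ 2 / 6) •
        (fderiv ℝ L q₀ (L q₀) + (2 : ℝ) • fderiv ℝ L (Qstar Δt) (L (Qstar Δt)))) :
    ∃ C > (0 : ℝ), ∃ δ > (0 : ℝ), ∀ Δt ∈ Set.Ioc (0 : ℝ) δ,
      ‖S Δt - y Δt‖ ≤ C * Δt ^ 5 := by
  subst hy0
  have hyd : deriv y = fun t => L (y t) := funext fun t => (hy t).deriv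
  have hydiff : Differentiable ℝ y := fun t => (hy t).differentiableAt
  have step : ∀ n : ℕ, n ≤ 4 → ContDiff ℝ n y → ContDiff ℝ (n + 1) y := by
    intro n hn h
    rw [contDiff_succ_iff_deriv]
    refine ⟨hydiff, by simp, ?_⟩
    rw [hyd]
    exact (hL.of_le (by exact_mod_cast hn)).comp h
  have y0 : ContDiff ℝ (0:ℕ) y := by
    simpa [contDiff_zero] using hydiff.continuous
  have y1 : ContDiff ℝ (1:ℕ) y := by simpa using step 0 (by norm_num) y0
  have y2 : ContDiff ℝ (2:ℕ) y := by exact_mod_cast step 1 (by norm_num) y1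
  have y3 : ContDiff ℝ (3:ℕ) y := by exact_mod_cast step 2 (by norm_num) y2
  set G : E → E := fun q => fderiv ℝ L q (L q) with hG
  have hG3 : ContDiff ℝ 3 G :=
    (hL.fderiv_right (m := 3) (by norm_num)).clm_apply (hL.of_le (by norm_num))
  set z : ℝ → E := fun t => G (y t) with hz
  have z3 : ContDiff ℝ (2+1) z := by
    have : ContDiff ℝ 3 z := hG3.comp (by exact_mod_cast y3)
    convert this using 1; norm_num
  obtain ⟨dz, -, z2⟩ := contDiff_succ_iff_deriv.1 z3
  have z2' : ContDiff ℝ (1+1) (deriv z) := by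
    rw [show (1 + 1 : WithTop ℕ∞) = 2 from one_add_one_eq_two]; exact z2
  obtain ⟨dz1, -, z1⟩ := contDiff_succ_iff_deriv.1 z2'
  have dz2 : Differentiable ℝ (deriv (deriv z)) := z1.differentiable (by norm_num)
  have cz3 : Continuous (deriv (deriv (deriv z))) := z1.continuous_deriv (by norm_num)
  have hLy : ∀ t, HasDerivAt (fun t => L (y t)) (z t) t := fun t =>
    ((hL.differentiable (by norm_num)) (y t)).hasFDerivAt.comp_hasDerivAt t (hy t)
  have bdd : ∀ f : ℝ → E, Continuous f → ∃ C, 0 ≤ C ∧ ∀ t ∈ Set.Icc (0:ℝ) 1, ‖f t‖ ≤ C * t ^ 0 := by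
    intro f hf
    obtain ⟨C, hC⟩ := isCompact_Icc.exists_bound_of_continuousOn (s := Set.Icc (0:ℝ) 1) hf.continuousOn
    exact ⟨C, (norm_nonneg _).trans (hC 0 (by simp)), by simpa using hC⟩
  obtain ⟨A, hA, hA3⟩ := bdd _ cz3
  obtain ⟨B, hB, hB1⟩ := bdd _ z2.continuous
  have hp : ∀ (n : ℕ) (c : ℝ) (v : E) (t : ℝ), HasDerivAt (fun t : ℝ => (c * t ^ (n+1)) • v)
      ((c * ((n+1) * t ^ n)) • v) t := by
    intro n c v t
    have := ((hasDerivAt_pow (n+1) t).const_mul c).smul_const v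
    simpa using this
  have e1 := aux_int (fun t => deriv (deriv z) t - deriv (deriv z) 0) _
    (fun t => (dz2 t).hasDerivAt.sub_const _) (by simp) A hA 0 hA3
  have e2 := aux_int (fun t => deriv z t - deriv z 0 - ((1:ℝ) * t ^ (0+1)) • deriv (deriv z) 0) _
    (fun t => ((dz1 t).hasDerivAt.sub_const _).sub (hp 0 1 _ t)) (by simp) A hA 1
    (fun t ht => by simpa using e1 t ht)
  have e3 := aux_int (fun t => z t - z 0 - ((1:ℝ) * t ^ (0+1)) • deriv z 0
      - ((1/2:ℝ) * t ^ (1+1)) • deriv (deriv z) 0) _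
    (fun t => (((dz t).hasDerivAt.sub_const _).sub (hp 0 1 _ t)).sub (hp 1 (1/2) _ t)) (by simp) A hA 2
    (fun t ht => by
      convert e2 t ht using 2
      push_cast
      module)
  have e4 := aux_int (fun t => L (y t) - L (y 0) - ((1:ℝ) * t ^ (0+1)) • z 0
      - ((1/2:ℝ) * t ^ (1+1)) • deriv z 0 - ((1/6:ℝ) * t ^ (2+1)) • deriv (deriv z) 0) _
    (fun t => ((((hLy t).sub_const _).sub (hp 0 1 _ t)).sub (hp 1 (1/2) _ t)).sub (hp 2 (1/6) _ t))
    (by simp) A hA 3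
    (fun t ht => by
      convert e3 t ht using 2
      push_cast
      module)
  have e5 := aux_int (fun t => y t - y 0 - ((1:ℝ) * t ^ (0+1)) • L (y 0)
      - ((1/2:ℝ) * t ^ (1+1)) • z 0
      - ((1/6:ℝ) * t ^ (2+1)) • deriv z 0 - ((1/24:ℝ) * t ^ (3+1)) • deriv (deriv z) 0) _
    (fun t => (((((hy t).sub_const _).sub (hp 0 1 _ t)).sub (hp 1 (1/2) _ t)).sub
      (hp 2 (1/6) _ t)).sub (hp 3 (1/24) _ t))
    (by simp) A hA 4
    (fun t ht => by
      convert e4 t ht using 2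
      push_cast
      module)
  have d1 := aux_int (fun t => z t - z 0) _
    (fun t => (dz t).hasDerivAt.sub_const _) (by simp) B hB 0 hB1
  have d2 := aux_int (fun t => L (y t) - L (y 0) - ((1:ℝ) * t ^ (0+1)) • z 0) _
    (fun t => ((hLy t).sub_const _).sub (hp 0 1 _ t)) (by simp) B hB 1
    (fun t ht => by simpa using d1 t ht)
  have d3 := aux_int (fun t => y t - y 0 - ((1:ℝ) * t ^ (0+1)) • L (y 0)
      - ((1/2:ℝ) * t ^ (1+1)) • z 0) _
    (fun t => (((hy t).sub_const _).sub (hp 0 1 _ t)).sub (hp 1 (1/2) _ t)) (by simp) B hB 2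
    (fun t ht => by
      convert d2 t ht using 2
      push_cast
      module)
  obtain ⟨K, U, hU, hK⟩ := (hG3.contDiffAt (x := y 0)).of_le (show (1:WithTop ℕ∞) ≤ 3 by norm_num)
    |>.exists_lipschitzOnWith
  have cQ : Continuous Qstar := by
    rw [show Qstar = _ from funext hQstar]; fun_prop
  have Q0 : Qstar 0 = y 0 := by simp [hQstar]
  have evQ : ∀ᶠ h in nhds (0:ℝ), Qstar h ∈ U :=
    cQ.continuousAt.eventually_mem (by rw [Q0]; exact hU)
  have evy : ∀ᶠ h in nhds (0:ℝ), y (h/2) ∈ U :=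
    (hydiff.continuous.comp (continuous_id.div_const 2)).continuousAt.eventually_mem
      (by simpa using hU)
  obtain ⟨ε, hε, hball⟩ := Metric.eventually_nhds_iff.1 (evQ.and evy)
  refine ⟨K * B + 2 * A + 1, by positivity, min 1 (ε/2), by positivity, ?_⟩
  rintro h ⟨h0, hδ⟩
  have h1 : h ≤ 1 := hδ.trans (min_le_left _ _)
  obtain ⟨u1, u2⟩ := hball (y := h) (by
    rw [Real.dist_eq, sub_zero, abs_of_pos h0]
    linarith [hδ.trans (min_le_right _ _)])
  have l1 : ‖G (Qstar h) - z (h/2)‖ ≤ K * (B * (h/2)^3) := by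
    have a := hK.norm_sub_le u1 u2
    have b := d3 (h/2) ⟨by linarith, by linarith⟩
    refine a.trans ?_
    gcongr
    rw [norm_sub_rev]
    refine le_trans (le_of_eq ?_) b
    congr 1
    rw [hQstar]
    simp only [hz, hG]
    module
  have l2 := e3 (h/2) ⟨by linarith, by linarith⟩
  have l3 := e5 h ⟨h0.le, h1⟩
  have key : S h - y h = (h^2/3) • (G (Qstar h) - z (h/2))
      + (h^2/3) • (z (h/2) - z 0 - ((1:ℝ) * (h/2) ^ (0+1)) • deriv z 0
      - ((1/2:ℝ) * (h/2) ^ (1+1)) • deriv (deriv z) 0)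
      - (y h - y 0 - ((1:ℝ) * h ^ (0+1)) • L (y 0)
      - ((1/2:ℝ) * h ^ (1+1)) • z 0
      - ((1/6:ℝ) * h ^ (2+1)) • deriv z 0 - ((1/24:ℝ) * h ^ (3+1)) • deriv (deriv z) 0) := by
    rw [hS]
    have g1 : fderiv ℝ L (y 0) (L (y 0)) = z 0 := rfl
    have g2 : fderiv ℝ L (Qstar h) (L (Qstar h)) = G (Qstar h) := rfl
    rw [g1, g2]
    module
  rw [key]
  have hK0 : (0:ℝ) ≤ K := K.2
  have hs : (0:ℝ) ≤ h^2/3 := by positivity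
  refine (norm_sub_le _ _).trans ((add_le_add (norm_add_le _ _) l3).trans ?_)
  rw [norm_smul, norm_smul, Real.norm_of_nonneg hs]
  have m1 := mul_le_mul_of_nonneg_left l1 hs
  have m2 := mul_le_mul_of_nonneg_left l2 hs
  refine (add_le_add (add_le_add m1 m2) le_rfl).trans ?_
  have h5 : 0 < h^5 := by positivity
  have k1 : 0 ≤ K * B * h^5 := by positivity
  have k2 : 0 ≤ A * h^5 := by positivity
  ring_nf
  ring_nf at k1 k2
  nlinarith
end

section
/- Let k ≥ 1 be a natural number, let Q, A ∈ ℝ and B₁, …, B₂₄ ∈ ℝ, and let γ₀, γ₁, …, γ₂₄ > 0 be linear weights with γ₀ + γ₁ + ⋯ + γ₂₄ = 1. Suppose P₀, P₁, …, P₂₄ : (0, δ) → ℝ satisfy |P₀(h) − Q − A·h³| ≤ C·h⁴ and |Pₘ(h) − Q − Bₘ·h²| ≤ C·h³ for m = 1, …, 24, and suppose normalized nonlinear weights ω̄₀, …, ω̄₂₄ : (0, δ) → ℝ satisfy Σₘ₌₀²⁴ ω̄ₘ(h) = 1 and |ω̄ₘ(h) − γₘ| ≤ C·γₘ·hᵏ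 for every m. Define P̃(h) = (ω̄₀(h)/γ₀)·P₀(h) + Σₘ₌₁²⁴ ( ω̄ₘ(h) − ω̄₀(h)·γₘ/γ₀ )·Pₘ(h). Then there exist C' > 0 and δ' > 0 such that |P̃(h) − Q| ≤ C'·(h^{2+k} + h³) for all h ∈ (0, δ'). -/
open Finset

/-- Accuracy of the WENO-AO reconstruction under the sufficient condition
`ω̄ₘ = γₘ(1 + O(hᵏ))`: with a third-order big-stencil polynomial `P₀`
(leading error `A·h³`) and second-order sub-stencil polynomials `Pₘ`
(leading errors `Bₘ·h²`, m = 1,…,24), the reconstructed value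
`P̃ = (ω̄₀/γ₀)·P₀ + Σₘ (ω̄ₘ − ω̄₀γₘ/γ₀)·Pₘ` satisfies
`|P̃(h) − Q| ≤ C'(h^{2+k} + h³)` for small `h > 0`. -/
theorem weno_ao_accuracy_general
    (k : ℕ) (hk : 1 ≤ k)
    (Q A : ℝ) (B : ℕ → ℝ) (γ : ℕ → ℝ)
    (hγpos : ∀ m ≤ 24, 0 < γ m)
    (hγsum : ∑ m ∈ range 25, γ m = 1)
    (δ C : ℝ) (hδ : 0 < δ) (hC : 0 < C)
    (P : ℕ → ℝ → ℝ)
    (hP0 : ∀ h ∈ Set.Ioo (0 : ℝ) δ, |P 0 h - Q - A * h ^ 3| ≤ C * h ^ 4)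
    (hPm : ∀ m, 1 ≤ m → m ≤ 24 → ∀ h ∈ Set.Ioo (0 : ℝ) δ,
      |P m h - Q - B m * h ^ 2| ≤ C * h ^ 3)
    (ω : ℕ → ℝ → ℝ)
    (hωsum : ∀ h ∈ Set.Ioo (0 : ℝ) δ, ∑ m ∈ range 25, ω m h = 1)
    (hω : ∀ m ≤ 24, ∀ h ∈ Set.Ioo (0 : ℝ) δ,
      |ω m h - γ m| ≤ C * γ m * h ^ k)
    (Ptilde : ℝ → ℝ)
    (hPtilde : ∀ h : ℝ, Ptilde h =
      ω 0 h / γ 0 * P 0 h +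
        ∑ m ∈ Icc 1 24, (ω m h - ω 0 h * γ m / γ 0) * P m h) :
    ∃ C' > (0 : ℝ), ∃ δ' > (0 : ℝ), ∀ h ∈ Set.Ioo (0 : ℝ) δ',
      |Ptilde h - Q| ≤ C' * (h ^ (2 + k) + h ^ 3) := by
  have h0 := hγpos 0 (by norm_num)
  have hsplit : ∀ f : ℕ → ℝ, ∑ m ∈ range 25, f m = f 0 + ∑ m ∈ Icc 1 24, f m := by
    intro f
    have e : range 25 = insert 0 (Icc 1 24) := by decide
    rw [e, Finset.sum_insert (by simp)]
  have hS : 0 ≤ ∑ m ∈ Icc 1 24, 2 * C * γ m * (|B m| + C) := by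
    apply Finset.sum_nonneg
    intro m hm
    have := hγpos m (Finset.mem_Icc.1 hm).2
    positivity
  have hA : 0 < (1 + C) * (|A| + C) := by positivity
  refine ⟨(1 + C) * (|A| + C) + ∑ m ∈ Icc 1 24, 2 * C * γ m * (|B m| + C), by linarith,
    min δ 1, lt_min hδ one_pos, ?_⟩
  rintro h ⟨hpos, hlt⟩
  have hh : h ∈ Set.Ioo (0 : ℝ) δ := ⟨hpos, hlt.trans_le (min_le_left _ _)⟩
  have h1 : h ≤ 1 := (hlt.trans_le (min_le_right _ _)).le
  have hk1 : h ^ k ≤ 1 := pow_le_one₀ hpos.le h1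
  have es := hωsum h hh
  rw [hsplit] at es hγsum
  have key : Ptilde h - Q = ω 0 h / γ 0 * (P 0 h - Q) +
      ∑ m ∈ Icc 1 24, (ω m h - ω 0 h * γ m / γ 0) * (P m h - Q) := by
    have e1 : ∑ m ∈ Icc 1 24, (ω m h - ω 0 h * γ m / γ 0)
        = (1 - ω 0 h) - ω 0 h * (1 - γ 0) / γ 0 := by
      rw [Finset.sum_sub_distrib, ← Finset.sum_div, ← Finset.mul_sum,
        eq_sub_of_add_eq' es, eq_sub_of_add_eq' hγsum]
    have e2 : ∑ m ∈ Icc 1 24, (ω m h - ω 0 h * γ m / γ 0) * (P m h - Q)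
        = ∑ m ∈ Icc 1 24, (ω m h - ω 0 h * γ m / γ 0) * P m h
          - (∑ m ∈ Icc 1 24, (ω m h - ω 0 h * γ m / γ 0)) * Q := by
      rw [Finset.sum_mul, ← Finset.sum_sub_distrib]
      exact Finset.sum_congr rfl fun m _ => by ring
    rw [e2, e1, hPtilde]
    field_simp
    ring
  have w0 : |ω 0 h / γ 0 - 1| ≤ C * h ^ k := by
    have : ω 0 h / γ 0 - 1 = (ω 0 h - γ 0) / γ 0 := by field_simp
    rw [this, abs_div, abs_of_pos h0, div_le_iff₀ h0]
    linarith [hω 0 (by norm_num) h hh]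
  have w1 : |ω 0 h / γ 0| ≤ 1 + C := by
    have := abs_le.1 (w0.trans (mul_le_of_le_one_right hC.le hk1))
    rw [abs_le]
    constructor <;> linarith [this.1, this.2]
  have b0 : |P 0 h - Q| ≤ (|A| + C) * h ^ 3 := by
    have t := abs_add_le (P 0 h - Q - A * h ^ 3) (A * h ^ 3)
    rw [sub_add_cancel, abs_mul, abs_of_pos (pow_pos hpos 3)] at t
    have : C * h ^ 4 ≤ C * h ^ 3 :=
      mul_le_mul_of_nonneg_left (pow_le_pow_of_le_one hpos.le h1 (by norm_num)) hC.le
    linarith [hP0 h hh]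
  have bm : ∀ m ∈ Icc 1 24, |(ω m h - ω 0 h * γ m / γ 0) * (P m h - Q)|
      ≤ 2 * C * γ m * (|B m| + C) * h ^ (2 + k) := by
    intro m hm
    obtain ⟨hm1, hm2⟩ := Finset.mem_Icc.1 hm
    have hg := hγpos m hm2
    have c1 : |ω m h - ω 0 h * γ m / γ 0| ≤ 2 * C * γ m * h ^ k := by
      have e : ω m h - ω 0 h * γ m / γ 0 = (ω m h - γ m) - γ m * (ω 0 h / γ 0 - 1) := by
        ring
      have t := abs_sub (ω m h - γ m) (γ m * (ω 0 h / γ 0 - 1))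
      rw [abs_mul, abs_of_pos hg] at t
      rw [e]
      have := mul_le_mul_of_nonneg_left w0 hg.le
      linarith [hω m hm2 h hh]
    have c2 : |P m h - Q| ≤ (|B m| + C) * h ^ 2 := by
      have t := abs_add_le (P m h - Q - B m * h ^ 2) (B m * h ^ 2)
      rw [sub_add_cancel, abs_mul, abs_of_pos (pow_pos hpos 2)] at t
      have : C * h ^ 3 ≤ C * h ^ 2 :=
        mul_le_mul_of_nonneg_left (pow_le_pow_of_le_one hpos.le h1 (by norm_num)) hC.le
      linarith [hPm m hm1 hm2 h hh]
    rw [abs_mul]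
    calc _ ≤ (2 * C * γ m * h ^ k) * ((|B m| + C) * h ^ 2) :=
          mul_le_mul c1 c2 (abs_nonneg _) (by positivity)
      _ = _ := by ring
  have s1 := (Finset.abs_sum_le_sum_abs _ _).trans (Finset.sum_le_sum bm)
  rw [← Finset.sum_mul] at s1
  have s0 : |ω 0 h / γ 0 * (P 0 h - Q)| ≤ (1 + C) * (|A| + C) * h ^ 3 := by
    rw [abs_mul, mul_assoc]
    exact mul_le_mul w1 b0 (abs_nonneg _) (by positivity)
  have s2 := abs_add_le (ω 0 h / γ 0 * (P 0 h - Q))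
    (∑ m ∈ Icc 1 24, (ω m h - ω 0 h * γ m / γ 0) * (P m h - Q))
  rw [key]
  have p1 := mul_nonneg hA.le (pow_pos hpos (2 + k)).le
  have p2 := mul_nonneg hS (pow_pos hpos 3).le
  linarith
end

section
/- Let Q, A ∈ ℝ and B₁, …, B₂₄ ∈ ℝ, and let γ₀, γ₁, …, γ₂₄ > 0 be linear weights with γ₀ + γ₁ + ⋯ + γ₂₄ = 1. Suppose P₀, P₁, …, P₂₄ : (0, δ) → ℝ satisfy |P₀(h) − Q − A·h³| ≤ C·h⁴ and |Pₘ(h) − Q − Bₘ·h²| ≤ C·h³ for m = 1, …, 24, and suppose normalized nonlinear weights ω̄₀, …, ω̄₂₄ : (0, δ) → ℝ satisfy Σₘ₌₀²⁴ ω̄ₘ(h) = 1 and |ω̄ₘ(h) − γₘ| ≤ C·γₘ·h for every m (the sufficient condition with k = 1). Define P̃(h) = (ω̄₀(h)/γ₀)·P₀(h) + Σₘ₌₁²⁴ ( ω̄ₘ(h) − ω̄₀(h)·γₘ/γ₀ )·Pₘ(h). Then the reconstruction is third-order accurate: there exist C' > 0 and δ' > 0 such that |P̃(h) − Q| ≤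 C'·h³ for all h ∈ (0, δ'). -/
open Finset

/-- Third-order accuracy of the WENO-AO reconstruction with `k = 1` in the
sufficient condition `ω̄ₘ = γₘ(1 + O(h))`: with a third-order big-stencil
polynomial `P₀` and second-order sub-stencil polynomials `Pₘ` (m = 1,…,24),
the reconstructed value `P̃ = (ω̄₀/γ₀)·P₀ + Σₘ (ω̄ₘ − ω̄₀γₘ/γ₀)·Pₘ`
satisfies `|P̃(h) − Q| ≤ C'·h³` for small `h > 0`. -/
theorem weno_ao_third_order_accuracy
    (Q A : ℝ) (B : ℕ → ℝ) (γ : ℕ → ℝ)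
    (hγpos : ∀ m ≤ 24, 0 < γ m)
    (hγsum : ∑ m ∈ range 25, γ m = 1)
    (δ C : ℝ) (hδ : 0 < δ) (hC : 0 < C)
    (P : ℕ → ℝ → ℝ)
    (hP0 : ∀ h ∈ Set.Ioo (0 : ℝ) δ, |P 0 h - Q - A * h ^ 3| ≤ C * h ^ 4)
    (hPm : ∀ m, 1 ≤ m → m ≤ 24 → ∀ h ∈ Set.Ioo (0 : ℝ) δ,
      |P m h - Q - B m * h ^ 2| ≤ C * h ^ 3)
    (ω : ℕ → ℝ → ℝ)
    (hωsum : ∀ h ∈ Set.Ioo (0 : ℝ) δ, ∑ m ∈ range 25, ω m h = 1)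
    (hω : ∀ m ≤ 24, ∀ h ∈ Set.Ioo (0 : ℝ) δ,
      |ω m h - γ m| ≤ C * γ m * h)
    (Ptilde : ℝ → ℝ)
    (hPtilde : ∀ h : ℝ, Ptilde h =
      ω 0 h / γ 0 * P 0 h +
        ∑ m ∈ Icc 1 24, (ω m h - ω 0 h * γ m / γ 0) * P m h) :
    ∃ C' > (0 : ℝ), ∃ δ' > (0 : ℝ), ∀ h ∈ Set.Ioo (0 : ℝ) δ',
      |Ptilde h - Q| ≤ C' * h ^ 3 := by
  have hg0 : 0 < γ 0 := hγpos 0 (by norm_num)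
  have hsplit : ∀ f : ℕ → ℝ, ∑ m ∈ range 25, f m = f 0 + ∑ m ∈ Icc 1 24, f m := by
    intro f
    have h1 : range 25 = insert 0 (Icc 1 24) := by decide
    rw [h1, Finset.sum_insert (by simp)]
  have hSnn : 0 ≤ ∑ m ∈ Icc 1 24, 2 * C * γ m * (|B m| + C) := by
    apply Finset.sum_nonneg
    intro m hm
    have := hγpos m (Finset.mem_Icc.mp hm).2
    positivity
  refine ⟨(1 + C) * (|A| + C) + ∑ m ∈ Icc 1 24, 2 * C * γ m * (|B m| + C), by positivity,
    min δ 1, by positivity, ?_⟩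
  intro h hh
  have h0 : 0 < h := hh.1
  have h1 : h ≤ 1 := (lt_of_lt_of_le hh.2 (min_le_right _ _)).le
  have hI : h ∈ Set.Ioo (0 : ℝ) δ := ⟨h0, lt_of_lt_of_le hh.2 (min_le_left _ _)⟩
  obtain ⟨r, hr⟩ : ∃ r, r = ω 0 h / γ 0 := ⟨_, rfl⟩
  have hrw : ω 0 h = r * γ 0 := by rw [hr]; field_simp
  have hr1 : |r - 1| ≤ C * h := by
    have h2 := hω 0 (by norm_num) h hI
    have h3 : ω 0 h - γ 0 = (r - 1) * γ 0 := by rw [hrw]; ring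
    rw [h3, abs_mul, abs_of_pos hg0] at h2
    have h4 : |r - 1| * γ 0 ≤ (C * h) * γ 0 := by linarith
    exact le_of_mul_le_mul_right h4 hg0
  have hCh : C * h ≤ C := by nlinarith
  have hrabs : |r| ≤ 1 + C := by
    rw [abs_le] at hr1 ⊢
    constructor <;> linarith [hr1.1, hr1.2]
  have key : Ptilde h - Q = r * (P 0 h - Q) +
      ∑ m ∈ Icc 1 24, (ω m h - r * γ m) * (P m h - Q) := by
    have e1 : ∑ m ∈ Icc 1 24, (ω m h - r * γ m) * (P m h - Q) =
        ∑ m ∈ Icc 1 24, (ω m h - r * γ m) * P m h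
          - (∑ m ∈ Icc 1 24, ω m h - r * ∑ m ∈ Icc 1 24, γ m) * Q := by
      rw [Finset.mul_sum, ← Finset.sum_sub_distrib, Finset.sum_mul, ← Finset.sum_sub_distrib]
      exact Finset.sum_congr rfl fun m _ => by ring
    have e2 : ∑ m ∈ Icc 1 24, (ω m h - ω 0 h * γ m / γ 0) * P m h =
        ∑ m ∈ Icc 1 24, (ω m h - r * γ m) * P m h :=
      Finset.sum_congr rfl fun m _ => by rw [hr]; ring
    have e3 := hωsum h hI
    rw [hsplit] at e3 hγsum
    have e4 : ∑ m ∈ Icc 1 24, ω m h = 1 - r * γ 0 := by linarith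
    have e5 : ∑ m ∈ Icc 1 24, γ m = 1 - γ 0 := by linarith
    rw [hPtilde, e2, e1, e4, e5, ← hr]
    ring
  have b0 : |P 0 h - Q| ≤ (|A| + C) * h ^ 3 := by
    have h2 := hP0 h hI
    have h3 : |P 0 h - Q| ≤ |P 0 h - Q - A * h ^ 3| + |A * h ^ 3| := by
      have h5 := abs_add_le (P 0 h - Q - A * h ^ 3) (A * h ^ 3)
      rwa [sub_add_cancel] at h5
    rw [abs_mul, abs_of_pos (pow_pos h0 3)] at h3
    have h4 : C * h ^ 4 ≤ C * h ^ 3 :=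
      mul_le_mul_of_nonneg_left (pow_le_pow_of_le_one h0.le h1 (by norm_num)) hC.le
    linarith
  have bm : ∀ m ∈ Icc 1 24, |(ω m h - r * γ m) * (P m h - Q)| ≤
      2 * C * γ m * (|B m| + C) * h ^ 3 := by
    intro m hm
    obtain ⟨hm1, hm2⟩ := Finset.mem_Icc.mp hm
    have hg := hγpos m hm2
    have h2 := hPm m hm1 hm2 h hI
    have h3 : |P m h - Q| ≤ |P m h - Q - B m * h ^ 2| + |B m * h ^ 2| := by
      have h5 := abs_add_le (P m h - Q - B m * h ^ 2) (B m * h ^ 2)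
      rwa [sub_add_cancel] at h5
    rw [abs_mul (B m), abs_of_pos (pow_pos h0 2)] at h3
    have h4 : C * h ^ 3 ≤ C * h ^ 2 :=
      mul_le_mul_of_nonneg_left (pow_le_pow_of_le_one h0.le h1 (by norm_num)) hC.le
    have h5 : |P m h - Q| ≤ (|B m| + C) * h ^ 2 := by linarith
    have h6 : |ω m h - r * γ m| ≤ 2 * C * γ m * h := by
      have h7 : ω m h - r * γ m = (ω m h - γ m) - (r - 1) * γ m := by ring
      have h8 := abs_sub (ω m h - γ m) ((r - 1) * γ m)
      rw [← h7, abs_mul, abs_of_pos hg] at h8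
      have h9 := hω m hm2 h hI
      have h10 := mul_le_mul_of_nonneg_right hr1 hg.le
      linarith
    rw [abs_mul]
    calc _ ≤ (2 * C * γ m * h) * ((|B m| + C) * h ^ 2) :=
          mul_le_mul h6 h5 (abs_nonneg _) (by positivity)
      _ = _ := by ring
  rw [key]
  calc _ ≤ |r * (P 0 h - Q)| + |∑ m ∈ Icc 1 24, (ω m h - r * γ m) * (P m h - Q)| :=
        abs_add_le _ _
    _ ≤ (1 + C) * ((|A| + C) * h ^ 3) +
        ∑ m ∈ Icc 1 24, 2 * C * γ m * (|B m| + C) * h ^ 3 := by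
        apply add_le_add
        · rw [abs_mul]
          exact mul_le_mul hrabs b0 (abs_nonneg _) (by positivity)
        · exact (Finset.abs_sum_le_sum_abs _ _).trans (Finset.sum_le_sum bm)
    _ = _ := by rw [← Finset.sum_mul]; ring
end

section
/- Let ε > 0, c > 0, C > 0 and let γ₀, γ₁, …, γ₂₄ > 0. Suppose β₀, β₁, …, β₂₄ : (0, δ) → ℝ are nonnegative functions satisfying β₀(h) = c·h²·(1 + e₀(h)) with |e₀(h)| ≤ C·h^{2/3}, and βₘ(h) = c·h²·(1 + eₘ(h)) with |eₘ(h)| ≤ C·h^{1/3} for m = 1, …, 24. Define τ(h) = Σₘ₌₁²⁴ |β₀(h) − βₘ(h)| / 24 and ωₘ(h) = γₘ·( 1 + τ(h)/(βₘ(h) + ε) ). Then ωₘ = γₘ(1 + O(h)): there exist C' > 0 and δ' > 0 such that |ωₘ(h) − γₘ| ≤ C'·γₘ·h for all m = 0, …, 24 and all h ∈ (0, δ'). -/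
open Finset

/-- With smooth indicators satisfying the Taylor expansions
`β₀ = c·h²(1 + O(h^{2/3}))` and `βₘ = c·h²(1 + O(h^{1/3}))` for m = 1,…,24,
the parameter `τ = Σₘ |β₀ − βₘ|/24` and the nonlinear weights
`ωₘ = γₘ(1 + τ/(βₘ + ε))` satisfy `ωₘ = γₘ(1 + O(h))`. -/
theorem weno_ao_nonlinear_weights_order
    (ε c C δ : ℝ) (hε : 0 < ε) (hc : 0 < c) (hC : 0 < C) (hδ : 0 < δ)
    (γ : ℕ → ℝ) (hγpos : ∀ m ≤ 24, 0 < γ m)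
    (β : ℕ → ℝ → ℝ)
    (hβnonneg : ∀ m ≤ 24, ∀ h ∈ Set.Ioo (0 : ℝ) δ, 0 ≤ β m h)
    (e : ℕ → ℝ → ℝ)
    (hβ : ∀ m ≤ 24, ∀ h ∈ Set.Ioo (0 : ℝ) δ,
      β m h = c * h ^ 2 * (1 + e m h))
    (he0 : ∀ h ∈ Set.Ioo (0 : ℝ) δ, |e 0 h| ≤ C * h ^ ((2 : ℝ) / 3))
    (hem : ∀ m, 1 ≤ m → m ≤ 24 → ∀ h ∈ Set.Ioo (0 : ℝ) δ,
      |e m h| ≤ C * h ^ ((1 : ℝ) / 3))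
    (τ : ℝ → ℝ)
    (hτ : ∀ h : ℝ, τ h = (∑ m ∈ Icc 1 24, |β 0 h - β m h|) / 24)
    (ω : ℕ → ℝ → ℝ)
    (hω : ∀ m h, ω m h = γ m * (1 + τ h / (β m h + ε))) :
    ∃ C' > (0 : ℝ), ∃ δ' > (0 : ℝ), ∀ m ≤ 24, ∀ h ∈ Set.Ioo (0 : ℝ) δ',
      |ω m h - γ m| ≤ C' * γ m * h := by
  refine ⟨2 * c * C / ε, by positivity, min δ 1, lt_min hδ one_pos, ?_⟩
  intro m hm h hh
  have h0 : 0 < h := hh.1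
  have h1 : h < 1 := lt_of_lt_of_le hh.2 (min_le_right _ _)
  have hmem : h ∈ Set.Ioo (0 : ℝ) δ := ⟨h0, lt_of_lt_of_le hh.2 (min_le_left _ _)⟩
  have hpow : ∀ p : ℝ, 0 ≤ p → C * h ^ p ≤ C := fun p hp =>
    mul_le_of_le_one_right hC.le (Real.rpow_le_one h0.le h1.le hp)
  have hE0 : |e 0 h| ≤ C := (he0 h hmem).trans (hpow _ (by norm_num))
  have hdiff : ∀ k ∈ Icc 1 24, |β 0 h - β k h| ≤ 2 * c * C * h := by
    intro k hk
    obtain ⟨hk1, hk2⟩ := Finset.mem_Icc.mp hk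
    have hEk : |e k h| ≤ C := (hem k hk1 hk2 h hmem).trans (hpow _ (by norm_num))
    have hsub : |e 0 h - e k h| ≤ 2 * C := (abs_sub _ _).trans (by linarith)
    have heq : β 0 h - β k h = c * h ^ 2 * (e 0 h - e k h) := by
      rw [hβ 0 (by norm_num) h hmem, hβ k hk2 h hmem]; ring
    rw [heq, abs_mul, abs_of_pos (by positivity : 0 < c * h ^ 2)]
    have hsq : h ^ 2 ≤ h := by nlinarith
    calc c * h ^ 2 * |e 0 h - e k h| ≤ c * h * (2 * C) := by gcongr
      _ = 2 * c * C * h := by ring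
  have hτ0 : 0 ≤ τ h := by
    rw [hτ]; positivity
  have hτ1 : τ h ≤ 2 * c * C * h := by
    have hs := Finset.sum_le_sum hdiff
    rw [Finset.sum_const, Nat.card_Icc, nsmul_eq_mul] at hs
    rw [hτ]
    norm_num at hs
    linarith
  have hβ0 := hβnonneg m hm h hmem
  have hγ := hγpos m hm
  have heq : ω m h - γ m = γ m * (τ h / (β m h + ε)) := by rw [hω]; ring
  rw [heq, abs_of_nonneg (by positivity)]
  calc γ m * (τ h / (β m h + ε)) ≤ γ m * (2 * c * C * h / ε) := by
        gcongr
        linarith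
    _ = 2 * c * C / ε * γ m * h := by ring
end
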